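/- Let X be the maximum of K i.i.d. Exponential(1) random variables. Then for any φ > 0, E[log₂(1 + φX)] = (1/ln 2) Σ_{l=1}^{K} C(K,l) (−1)^l e^{l/φ} Ei(−l/φ). -/

import Mathlib

open MeasureTheory Real Filter

/-- `EiNeg y = Ei(-y) = -∫_y^∞ e^{-t}/t dt` for `y > 0`, the exponential integral. -/
noncomputable def EiNeg (y : ℝ) : ℝ := -∫ t in Set.Ioi y, Real.exp (-t) / t

lemma ei_integrable (φ : ℝ) (hφ : 0 < φ) (l : ℕ) (hl : 1 ≤ l) :
    IntegrableOn (fun t : ℝ => Real.exp (-(l * t)) * (φ / (1 + φ * t))) (Set.Ioi 0) := by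
  have hl0 : (0 : ℝ) < l := by exact_mod_cast hl
  have h1 : IntegrableOn (fun t : ℝ => Real.exp (-(l : ℝ) * t) * φ) (Set.Ioi 0) :=
    (exp_neg_integrableOn_Ioi 0 hl0).mul_const φ
  refine Integrable.mono' h1 (by fun_prop) ?_
  refine (ae_restrict_iff' measurableSet_Ioi).2 (Eventually.of_forall fun t ht => ?_)
  have ht : 0 < t := ht
  have hp : 0 < φ * t := mul_pos hφ ht
  rw [Real.norm_of_nonneg (by positivity), neg_mul]
  gcongr
  exact div_le_self hφ.le (by linarith)

lemma ei_integral (φ : ℝ) (hφ : 0 < φ) (l : ℕ) (hl : 1 ≤ l) :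
    ∫ t in Set.Ioi (0 : ℝ), Real.exp (-(l * t)) * (φ / (1 + φ * t))
      = - (Real.exp (l / φ) * EiNeg (l / φ)) := by
  have hl0 : (0 : ℝ) < l := by exact_mod_cast hl
  have h1 := integral_comp_mul_left_Ioi (fun u : ℝ => Real.exp (-u) / u) (1 / φ) hl0
  have h2 : ∫ t in Set.Ioi (0 : ℝ), Real.exp (-(l * (t + 1 / φ))) / (l * (t + 1 / φ))
      = ∫ t in Set.Ioi (1 / φ : ℝ), Real.exp (-(l * t)) / (l * t) := by
    have := (measurePreserving_add_right volume (1 / φ : ℝ)).setIntegral_preimage_emb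
      (measurableEmbedding_addRight (1 / φ : ℝ))
      (fun t : ℝ => Real.exp (-(l * t)) / (l * t)) (Set.Ioi (1 / φ))
    rw [← this]
    simp
  have h3 : ∫ t in Set.Ioi (0 : ℝ), Real.exp (-(l * t)) * (φ / (1 + φ * t))
      = ∫ t in Set.Ioi (0 : ℝ), (l * Real.exp (l / φ)) *
        (Real.exp (-(l * (t + 1 / φ))) / (l * (t + 1 / φ))) := by
    refine setIntegral_congr_fun measurableSet_Ioi fun t ht => ?_
    have ht : 0 < t := ht
    have hp : 0 < φ * t := mul_pos hφ ht
    have e : Real.exp (-(l * t)) = Real.exp (l / φ) * Real.exp (-(l * (t + 1 / φ))) := by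
      rw [← Real.exp_add]; congr 1; ring
    rw [e]
    have : t + 1 / φ = (1 + φ * t) / φ := by field_simp; ring

    generalize Real.exp (-(l * (t + 1 / φ))) = A
    rw [this]
    field_simp
  rw [h3, integral_const_mul, h2, h1, EiNeg, smul_eq_mul, mul_one_div]
  field_simp

theorem expected_logb_of_max_of_exponentials
    {Ω : Type*} [MeasurableSpace Ω] (P : Measure Ω) [IsProbabilityMeasure P]
    (K : ℕ) (hK : 1 ≤ K)
    (X : Ω → ℝ) (hXmeas : Measurable X)
    (hcdf : ∀ x : ℝ, (P {ω | X ω ≤ x}).toReal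
      = if 0 ≤ x then (1 - Real.exp (-x)) ^ K else 0)
    (φ : ℝ) (hφ : 0 < φ)
    (hint : Integrable (fun ω => Real.logb 2 (1 + φ * X ω)) P) :
    ∫ ω, Real.logb 2 (1 + φ * X ω) ∂P
      = (1 / Real.log 2) * ∑ l ∈ Finset.Icc 1 K,
          (K.choose l : ℝ) * (-1) ^ l * Real.exp (l / φ) * EiNeg (l / φ) := by
  have hX : ∀ᵐ ω ∂P, 0 ≤ X ω := by
    have h0 := hcdf 0
    simp only [le_refl, if_true, neg_zero, Real.exp_zero, sub_self] at h0
    rw [zero_pow (by omega), ENNReal.toReal_eq_zero_iff] at h0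
    have h0 : P {ω | X ω ≤ 0} = 0 := h0.resolve_right (measure_ne_top _ _)
    rw [ae_iff]
    refine measure_mono_null (fun ω hω => ?_) h0
    simp only [Set.mem_setOf_eq, not_le] at hω ⊢
    exact hω.le
  have htail : ∀ t : ℝ, 0 < t →
      P {ω | t < X ω} = ENNReal.ofReal (1 - (1 - Real.exp (-t)) ^ K) := by
    intro t ht
    have hs : MeasurableSet {ω | X ω ≤ t} := measurableSet_le hXmeas measurable_const
    have hc : {ω | t < X ω} = {ω | X ω ≤ t}ᶜ := by ext; simp
    have h := hcdf t
    rw [if_pos ht.le] at h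
    have h2 := probReal_compl_eq_one_sub (μ := P) hs
    rw [hc, ← ofReal_measureReal, h2, measureReal_def, h]
  have hg : ∀ x : ℝ, 0 ≤ x →
      ∫ t in (0 : ℝ)..x, φ / (1 + φ * t) = Real.log (1 + φ * x) := by
    intro x hx
    have := intervalIntegral.integral_eq_sub_of_hasDerivAt
      (f := fun t => Real.log (1 + φ * t)) (f' := fun t => φ / (1 + φ * t)) (a := 0) (b := x)
      ?_ ?_
    · rw [this]; simp
    · intro t ht
      rw [Set.uIcc_of_le hx] at ht
      have : 0 ≤ φ * t := mul_nonneg hφ.le ht.1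
      have h1 : HasDerivAt (fun t => 1 + φ * t) φ t := by
        simpa using ((hasDerivAt_id t).const_mul φ).const_add 1
      exact h1.log (by positivity)
    · apply ContinuousOn.intervalIntegrable
      rw [Set.uIcc_of_le hx]
      refine continuousOn_const.div (by fun_prop) fun t ht => ?_
      have : 0 ≤ φ * t := mul_nonneg hφ.le ht.1
      positivity
  have hpow : ∀ t : ℝ, 0 < t → 0 ≤ 1 - (1 - Real.exp (-t)) ^ K := by
    intro t ht
    have h1 : Real.exp (-t) ≤ 1 := Real.exp_le_one_iff.2 (by linarith)
    have := pow_le_one₀ (n := K) (sub_nonneg.2 h1) (by linarith [Real.exp_pos (-t)])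
    linarith
  have hbin : ∀ t : ℝ, (1 - (1 - Real.exp (-t)) ^ K) * (φ / (1 + φ * t))
      = ∑ l ∈ Finset.Icc 1 K, (-((K.choose l : ℝ) * (-1) ^ l)) *
        (Real.exp (-(l * t)) * (φ / (1 + φ * t))) := by
    intro t
    have h1 : (1 - Real.exp (-t)) ^ K
        = ∑ l ∈ Finset.range (K + 1), (K.choose l : ℝ) * (-1) ^ l * Real.exp (-(l * t)) := by
      rw [show 1 - Real.exp (-t) = -Real.exp (-t) + 1 by ring, add_pow]
      refine Finset.sum_congr rfl fun l _ => ?_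
      rw [neg_pow, ← Real.exp_nat_mul, one_pow, mul_neg]
      ring
    rw [Finset.range_eq_Ico, Finset.sum_eq_sum_Ico_succ_bot (by omega)] at h1
    have h2 : Finset.Ico (0 + 1) (K + 1) = Finset.Icc 1 K := by ext; simp
    rw [h2] at h1
    rw [h1]
    simp only [Nat.choose_zero_right, Nat.cast_one, pow_zero, mul_one, Nat.cast_zero, zero_mul,
      neg_zero, Real.exp_zero, sub_add_cancel_left, neg_mul, Finset.sum_mul, Finset.sum_neg_distrib,
      mul_assoc]
  have hlog : ∫ ω, Real.log (1 + φ * X ω) ∂P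
      = ∫ t in Set.Ioi (0 : ℝ), (1 - (1 - Real.exp (-t)) ^ K) * (φ / (1 + φ * t)) := by
    rw [integral_eq_lintegral_of_nonneg_ae, integral_eq_lintegral_of_nonneg_ae]
    · congr 1
      have hL := lintegral_comp_eq_lintegral_meas_lt_mul P (f := X)
        (g := fun t => φ / (1 + φ * t)) hX hXmeas.aemeasurable ?_ ?_
      · calc _ = ∫⁻ ω, ENNReal.ofReal (∫ t in (0 : ℝ)..X ω, φ / (1 + φ * t)) ∂P := by
              refine lintegral_congr_ae ?_
              filter_upwards [hX] with ω hω
              rw [hg _ hω]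
          _ = _ := by
              rw [hL]
              refine setLIntegral_congr_fun measurableSet_Ioi fun t ht => ?_
              rw [htail t ht, ENNReal.ofReal_mul (hpow t ht)]
      · intro t ht
        apply ContinuousOn.intervalIntegrable
        rw [Set.uIcc_of_le (le_of_lt ht)]
        refine continuousOn_const.div (by fun_prop) fun t ht => ?_
        have : 0 ≤ φ * t := mul_nonneg hφ.le ht.1
        positivity
      · refine (ae_restrict_iff' measurableSet_Ioi).2 (Eventually.of_forall fun t ht => ?_)
        have : 0 ≤ φ * t := mul_nonneg hφ.le (le_of_lt ht)
        positivity
    · refine (ae_restrict_iff' measurableSet_Ioi).2 (Eventually.of_forall fun t ht => ?_)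
      have : 0 ≤ φ * t := mul_nonneg hφ.le (le_of_lt ht)
      exact mul_nonneg (hpow t ht) (by positivity)
    · exact Measurable.aestronglyMeasurable (by fun_prop)
    · filter_upwards [hX] with ω hω
      have : 0 ≤ φ * X ω := mul_nonneg hφ.le hω
      exact Real.log_nonneg (by linarith)
    · exact Measurable.aestronglyMeasurable (by fun_prop)
  simp only [Real.logb, integral_div]
  rw [hlog, div_eq_inv_mul, one_div]
  congr 1
  simp only [hbin]
  rw [integral_finset_sum]
  · refine Finset.sum_congr rfl fun l hl => ?_
    rw [integral_const_mul, ei_integral φ hφ l (Finset.mem_Icc.1 hl).1]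
    ring
  · intro l hl
    exact (ei_integrable φ hφ l (Finset.mem_Icc.1 hl).1).const_mul _
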